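/- Let α ∈ [0, 1/2), let (d_n) be a sequence of natural numbers diverging to infinity, and let (K_n) be a sequence of convex bodies with K_n ⊂ ℝ^{d_n} and diam(K_n) = O(d_n^α). Then the normalized random variables F_{K_n} = (dist²(X_{K_n},K_n) − E[dist²(X_{K_n},K_n)]) / √(Var(dist²(X_{K_n},K_n))) converge in distribution to the standard Gaussian law N(0,1) as n → ∞. -/

import Mathlib

open MeasureTheory ProbabilityTheory Metric Real

section PrekopaLeindlerInequality

open scoped ENNReal Pointwise

theorem volume_add_le_of_isCompact {K L : Set ℝ} (hK : IsCompact K) (hL : IsCompact L)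
    (hKn : K.Nonempty) (hLn : L.Nonempty) : volume K + volume L ≤ volume (K + L) := by
  obtain ⟨k, hk, hkmax⟩ := hK.exists_isGreatest hKn
  obtain ⟨l, hl, hlmin⟩ := hL.exists_isLeast hLn
  have h1 : volume ((· + l) '' K) = volume K := by simp
  have h2 : volume ((k + ·) '' L) = volume L := by simp
  have hint : volume ((· + l) '' K ∩ (k + ·) '' L) = 0 := by
    refine measure_mono_null (t := {k + l}) ?_ (by simp)
    rintro _ ⟨⟨x, hx, rfl⟩, ⟨y, hy, hxy⟩⟩
    have := hkmax hx
    have := hlmin hy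
    simp only [Set.mem_singleton_iff] at *
    linarith
  have hm : MeasurableSet ((k + ·) '' L) := (hL.image (by fun_prop)).measurableSet
  rw [← h1, ← h2, ← measure_union_add_inter _ hm, hint, add_zero]
  refine measure_mono (Set.union_subset ?_ ?_)
  · rintro _ ⟨x, hx, rfl⟩
    exact Set.add_mem_add hx hl
  · rintro _ ⟨x, hx, rfl⟩
    exact Set.add_mem_add hk hx

theorem volume_add_le_of_measurableSet {A B C : Set ℝ} (hA : MeasurableSet A)
    (hB : MeasurableSet B) (hAn : A.Nonempty) (hBn : B.Nonempty) (hC : A + B ⊆ C) :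
    volume A + volume B ≤ volume C := by
  obtain ⟨p, hp⟩ := hAn
  obtain ⟨q, hq⟩ := hBn
  rw [hA.measure_eq_iSup_isCompact, hB.measure_eq_iSup_isCompact]
  simp only [iSup_and']
  refine ENNReal.biSup_add_biSup_le' (p := fun K : Set ℝ => K ⊆ A ∧ IsCompact K)
    (q := fun K : Set ℝ => K ⊆ B ∧ IsCompact K) ⟨∅, by simp⟩ ⟨∅, by simp⟩ ?_
  rintro K ⟨hKA, hK⟩ L ⟨hLB, hL⟩
  have h := volume_add_le_of_isCompact (hK.insert p) (hL.insert q)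
    (Set.insert_nonempty _ _) (Set.insert_nonempty _ _)
  refine (add_le_add (measure_mono (Set.subset_insert p K))
    (measure_mono (Set.subset_insert q L))).trans (h.trans (measure_mono ?_))
  exact (Set.add_subset_add (Set.insert_subset hp hKA) (Set.insert_subset hq hLB)).trans hC

theorem lintegral_eq_lintegral_meas_lt_Ioo {f : ℝ → ℝ≥0∞} (hf : Measurable f)
    (hf1 : ∀ x, f x ≤ 1) :
    ∫⁻ x, f x = ∫⁻ t in Set.Ioo (0 : ℝ) 1, volume {x | ENNReal.ofReal t < f x} := by
  have hfin : ∀ x, f x ≠ ∞ := fun x => ((hf1 x).trans_lt ENNReal.one_lt_top).ne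
  have h := lintegral_eq_lintegral_meas_lt volume (f := fun x => (f x).toReal)
    (Filter.Eventually.of_forall fun x => ENNReal.toReal_nonneg) hf.ennreal_toReal.aemeasurable
  simp only [ENNReal.ofReal_toReal (hfin _)] at h
  rw [h, ← Set.Ioo_union_Ici_eq_Ioi (zero_lt_one' ℝ), lintegral_union measurableSet_Ici]
  · have h0 : ∫⁻ t in Set.Ici (1 : ℝ), volume {a | t < (f a).toReal} = 0 := by
      rw [setLIntegral_eq_zero measurableSet_Ici]
      intro t ht
      have : {a | t < (f a).toReal} = ∅ := by
        ext x
        have := ENNReal.toReal_mono ENNReal.one_ne_top (hf1 x)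
        simp only [Set.mem_Ici, ENNReal.toReal_one] at *
        simp only [Set.mem_ofPred_eq, Set.mem_empty_iff_false, iff_false, not_lt]
        linarith
      simp [this]
    rw [h0, add_zero]
    refine setLIntegral_congr_fun measurableSet_Ioo fun t ht => ?_
    congr 1
    ext x
    simp [ENNReal.ofReal_lt_iff_lt_toReal ht.1.le (hfin x)]
  · rw [Set.disjoint_left]
    intro x hx hx'
    exact absurd hx.2 (not_lt.mpr hx')

theorem ENNReal.rpow_mul_rpow_le_add {a b : ℝ} (ha : 0 < a) (hb : 0 < b) (hab : a + b = 1)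
    (x y : ℝ≥0∞) : x ^ a * y ^ b ≤ ENNReal.ofReal a * x + ENNReal.ofReal b * y := by
  rcases eq_or_ne x ∞ with rfl | hx
  · simp [ENNReal.mul_top, ha]
  rcases eq_or_ne y ∞ with rfl | hy
  · simp [ENNReal.mul_top, hb]
  lift x to NNReal using hx
  lift y to NNReal using hy
  have := NNReal.geom_mean_le_arith_mean2_weighted a.toNNReal b.toNNReal x y
    (by ext; simpa [ha.le, hb.le] using hab)
  rw [Real.coe_toNNReal a ha.le, Real.coe_toNNReal b hb.le] at this
  rw [← ENNReal.coe_rpow_of_nonneg _ ha.le, ← ENNReal.coe_rpow_of_nonneg _ hb.le]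
  unfold ENNReal.ofReal
  exact_mod_cast this

/-- The Prékopa–Leindler inequality, as a property of a measure on a real vector space. -/
def PrekopaLeindler {E : Type*} [AddCommGroup E] [Module ℝ E] [MeasurableSpace E]
    (μ : Measure E) : Prop :=
  ∀ a b : ℝ, 0 < a → 0 < b → a + b = 1 → ∀ f g h : E → ℝ≥0∞,
    Measurable f → Measurable g → Measurable h →
    (∀ x y, f x ^ a * g y ^ b ≤ h (a • x + b • y)) →
    (∫⁻ x, f x ∂μ) ^ a * (∫⁻ x, g x ∂μ) ^ b ≤ ∫⁻ x, h x ∂μ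

theorem lintegral_add_le_of_iSup_eq_one {a b : ℝ} (ha : 0 < a) (hb : 0 < b) (hab : a + b = 1)
    {f g h : ℝ → ℝ≥0∞} (hf : Measurable f) (hg : Measurable g) (hh : Measurable h)
    (hfs : ⨆ x, f x = 1) (hgs : ⨆ x, g x = 1)
    (hfgh : ∀ x y, f x ^ a * g y ^ b ≤ h (a • x + b • y)) :
    ENNReal.ofReal a * (∫⁻ x, f x) + ENNReal.ofReal b * (∫⁻ x, g x) ≤ ∫⁻ x, h x := by
  have hmin : ∫⁻ x, min (h x) 1 ≤ ∫⁻ x, h x := lintegral_mono fun x => min_le_left _ _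
  refine le_trans ?_ hmin
  have hm : ∀ u : ℝ → ℝ≥0∞, Measurable fun t : ℝ => volume {x | ENNReal.ofReal t < u x} := by
    intro u
    refine Antitone.measurable fun s t hst => measure_mono fun x hx => ?_
    exact (ENNReal.ofReal_le_ofReal hst).trans_lt hx
  rw [lintegral_eq_lintegral_meas_lt_Ioo hf fun x => hfs ▸ le_iSup f x,
    lintegral_eq_lintegral_meas_lt_Ioo hg fun x => hgs ▸ le_iSup g x,
    lintegral_eq_lintegral_meas_lt_Ioo (hh.min measurable_const) fun x => min_le_right _ _,
    ← lintegral_const_mul _ (hm f), ← lintegral_const_mul _ (hm g),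
    ← lintegral_add_left ((hm f).const_mul _)]
  refine setLIntegral_mono (hm _) fun t ht => ?_
  have ht1 : ENNReal.ofReal t < 1 := by simpa using ht.2
  have hfn : {x | ENNReal.ofReal t < f x}.Nonempty :=
    (lt_iSup_iff.mp (hfs ▸ ht1)).imp fun _ hx => hx
  have hgn : {x | ENNReal.ofReal t < g x}.Nonempty :=
    (lt_iSup_iff.mp (hgs ▸ ht1)).imp fun _ hx => hx
  have key := volume_add_le_of_measurableSet (A := a • {x | ENNReal.ofReal t < f x})
    (B := b • {x | ENNReal.ofReal t < g x}) (C := {x | ENNReal.ofReal t < min (h x) 1})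
    ((measurableSet_lt measurable_const hf).const_smul_of_ne_zero ha.ne')
    ((measurableSet_lt measurable_const hg).const_smul_of_ne_zero hb.ne')
    hfn.smul_set hgn.smul_set ?_
  · simpa [Measure.addHaar_smul, abs_of_pos ha, abs_of_pos hb] using key
  · rintro _ ⟨_, ⟨x, hx, rfl⟩, _, ⟨y, hy, rfl⟩, rfl⟩
    refine lt_min (lt_of_lt_of_le ?_ (hfgh x y)) ht1
    have : ENNReal.ofReal t = ENNReal.ofReal t ^ a * ENNReal.ofReal t ^ b := by
      rw [← ENNReal.rpow_add_of_nonneg _ _ ha.le hb.le, hab, ENNReal.rpow_one]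
    rw [this]
    exact ENNReal.mul_lt_mul (ENNReal.rpow_lt_rpow hx ha) (ENNReal.rpow_lt_rpow hy hb)

theorem prekopaLeindler_of_bounded {a b : ℝ} (ha : 0 < a) (hb : 0 < b) (hab : a + b = 1)
    {f g h : ℝ → ℝ≥0∞} (hf : Measurable f) (hg : Measurable g) (hh : Measurable h)
    (hfs : ⨆ x, f x ≠ ∞) (hgs : ⨆ x, g x ≠ ∞)
    (hfgh : ∀ x y, f x ^ a * g y ^ b ≤ h (a • x + b • y)) :
    (∫⁻ x, f x) ^ a * (∫⁻ x, g x) ^ b ≤ ∫⁻ x, h x := by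
  set A := ⨆ x, f x with hA
  set B := ⨆ x, g x with hB
  rcases eq_or_ne A 0 with hA0 | hA0
  · have : ∀ x, f x = 0 := by simpa [hA] using hA0
    simp [this, ENNReal.zero_rpow_of_pos ha]
  rcases eq_or_ne B 0 with hB0 | hB0
  · have : ∀ x, g x = 0 := by simpa [hB] using hB0
    simp [this, ENNReal.zero_rpow_of_pos hb]
  have hC0 : A ^ a * B ^ b ≠ 0 := by simp [hA0, hB0, hfs, hgs]
  have hCt : A ^ a * B ^ b ≠ ∞ :=
    ENNReal.mul_ne_top (ENNReal.rpow_ne_top_of_nonneg ha.le hfs)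
      (ENNReal.rpow_ne_top_of_nonneg hb.le hgs)
  have hinv : (A ^ a * B ^ b)⁻¹ = A⁻¹ ^ a * B⁻¹ ^ b := by
    rw [ENNReal.mul_inv (by simp [hA0, hfs]) (by simp [hA0, hfs]), ENNReal.inv_rpow,
      ENNReal.inv_rpow]
  have key := lintegral_add_le_of_iSup_eq_one ha hb hab (f := fun x => A⁻¹ * f x)
    (g := fun x => B⁻¹ * g x) (h := fun x => (A ^ a * B ^ b)⁻¹ * h x)
    (hf.const_mul _) (hg.const_mul _) (hh.const_mul _)
    (by rw [← ENNReal.mul_iSup, ← hA, ENNReal.inv_mul_cancel hA0 hfs])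
    (by rw [← ENNReal.mul_iSup, ← hB, ENNReal.inv_mul_cancel hB0 hgs])
    (fun x y => by
      rw [ENNReal.mul_rpow_of_nonneg _ _ ha.le, ENNReal.mul_rpow_of_nonneg _ _ hb.le, hinv,
        mul_mul_mul_comm]
      exact mul_le_mul_right (hfgh x y) _)
  have key2 := (ENNReal.rpow_mul_rpow_le_add ha hb hab _ _).trans key
  rw [lintegral_const_mul _ hf, lintegral_const_mul _ hg, lintegral_const_mul _ hh,
    ENNReal.mul_rpow_of_nonneg _ _ ha.le, ENNReal.mul_rpow_of_nonneg _ _ hb.le,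
    mul_mul_mul_comm, ← hinv] at key2
  exact (ENNReal.mul_le_mul_iff_right (ENNReal.inv_ne_zero.mpr hCt)
    (ENNReal.inv_ne_top.mpr hC0)).mp key2

theorem prekopaLeindler_real : PrekopaLeindler (volume : Measure ℝ) := by
  intro a b ha hb hab f g h hf hg hh hfgh
  have hlim : ∀ u : ℝ → ℝ≥0∞, Measurable u →
      Filter.Tendsto (fun n : ℕ => ∫⁻ x, min (u x) n) Filter.atTop (nhds (∫⁻ x, u x)) := by
    intro u hu
    refine lintegral_tendsto_of_tendsto_of_monotone
      (fun n => (hu.min measurable_const).aemeasurable)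
      (Filter.Eventually.of_forall fun x m n hmn => min_le_min_left _ (by exact_mod_cast hmn))
      (Filter.Eventually.of_forall fun x => ?_)
    have := (tendsto_const_nhds (x := u x)).min ENNReal.tendsto_nat_nhds_top
    simpa using this
  have hmono : ∀ u : ℝ → ℝ≥0∞, Monotone fun n : ℕ => ∫⁻ x, min (u x) n := fun u m n hmn =>
    lintegral_mono fun x => min_le_min_left _ (by exact_mod_cast hmn)
  have hsup : ∀ u : ℝ → ℝ≥0∞, Measurable u → ∀ c : ℝ, 0 < c →
      (∫⁻ x, u x) ^ c = ⨆ n : ℕ, (∫⁻ x, min (u x) n) ^ c := by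
    intro u hu c hc
    have h1 := ((ENNReal.continuous_rpow_const (y := c)).tendsto _).comp (hlim u hu)
    exact tendsto_nhds_unique h1 (tendsto_atTop_iSup fun m n hmn =>
      ENNReal.rpow_le_rpow (hmono u hmn) hc.le)
  rw [hsup f hf a ha, hsup g hg b hb, ENNReal.iSup_mul]
  simp only [ENNReal.mul_iSup]
  refine iSup_le fun i => iSup_le fun j => (mul_le_mul'
    (ENNReal.rpow_le_rpow (hmono f (le_max_left i j)) ha.le)
    (ENNReal.rpow_le_rpow (hmono g (le_max_right i j)) hb.le)).trans ?_
  generalize max i j = n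
  have hb' : ∀ u : ℝ → ℝ≥0∞, ⨆ x, min (u x) n ≠ ∞ := fun u =>
    ((iSup_le fun x => min_le_right _ _).trans_lt (ENNReal.natCast_lt_top n)).ne
  refine prekopaLeindler_of_bounded ha hb hab (hf.min measurable_const) (hg.min measurable_const)
    hh (hb' f) (hb' g) fun x y => le_trans ?_ (hfgh x y)
  exact mul_le_mul' (ENNReal.rpow_le_rpow (min_le_left _ _) ha.le)
    (ENNReal.rpow_le_rpow (min_le_left _ _) hb.le)

theorem PrekopaLeindler.prod {E F : Type*} [AddCommGroup E] [Module ℝ E] [MeasurableSpace E]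
    [AddCommGroup F] [Module ℝ F] [MeasurableSpace F] {μ : Measure E} {ν : Measure F}
    [SFinite μ] [SFinite ν] (hμ : PrekopaLeindler μ) (hν : PrekopaLeindler ν) :
    PrekopaLeindler (μ.prod ν) := by
  intro a b ha hb hab f g h hf hg hh hfgh
  rw [lintegral_prod _ hf.aemeasurable, lintegral_prod _ hg.aemeasurable,
    lintegral_prod _ hh.aemeasurable]
  refine hμ a b ha hb hab _ _ _ hf.lintegral_prod_right' hg.lintegral_prod_right'
    hh.lintegral_prod_right' fun x y => ?_
  refine hν a b ha hb hab _ _ _ (hf.comp measurable_prodMk_left) (hg.comp measurable_prodMk_left)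
    (hh.comp measurable_prodMk_left) fun u v => ?_
  simpa using hfgh (x, u) (y, v)

theorem PrekopaLeindler.of_measurableEquiv {E F : Type*} [AddCommGroup E] [Module ℝ E]
    [MeasurableSpace E] [AddCommGroup F] [Module ℝ F] [MeasurableSpace F] {μ : Measure E}
    {ν : Measure F} (hν : PrekopaLeindler ν) (e : E ≃ᵐ F) (he : MeasurePreserving e μ ν)
    (hlin : ∀ (a b : ℝ) (x y : E), e (a • x + b • y) = a • e x + b • e y) :
    PrekopaLeindler μ := by
  intro a b ha hb hab f g h hf hg hh hfgh
  have hs := he.symm e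
  have key := hν a b ha hb hab (f ∘ e.symm) (g ∘ e.symm) (h ∘ e.symm) (hf.comp e.symm.measurable)
    (hg.comp e.symm.measurable) (hh.comp e.symm.measurable) fun x y => by
      have : e.symm (a • x + b • y) = a • e.symm x + b • e.symm y := by
        apply e.injective
        rw [hlin]
        simp
      simpa [this] using hfgh (e.symm x) (e.symm y)
  simpa only [Function.comp_def, hs.lintegral_comp hf, hs.lintegral_comp hg,
    hs.lintegral_comp hh] using key

theorem prekopaLeindler_pi (n : ℕ) : PrekopaLeindler (volume : Measure (Fin n → ℝ)) := by
  induction n with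
  | zero =>
    intro a b ha hb hab f g h hf hg hh hfgh
    have := hfgh 0 0
    rw [volume_pi, Measure.pi_of_empty _ 0, lintegral_dirac, lintegral_dirac, lintegral_dirac]
    simpa using this
  | succ n ih =>
    exact (prekopaLeindler_real.prod ih).of_measurableEquiv
      (MeasurableEquiv.piFinSuccAbove (fun _ => ℝ) 0)
      (volume_preserving_piFinSuccAbove (fun _ => ℝ) 0) fun _ _ _ _ => rfl

theorem prekopaLeindler_euclideanSpace (n : ℕ) :
    PrekopaLeindler (volume : Measure (EuclideanSpace ℝ (Fin n))) :=
  (prekopaLeindler_pi n).of_measurableEquiv (MeasurableEquiv.toLp 2 (Fin n → ℝ)).symm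
    (EuclideanSpace.volume_preserving_symm_measurableEquiv_toLp (Fin n)) fun _ _ _ _ => rfl

end PrekopaLeindlerInequality

section

open scoped ENNReal Pointwise

section Wills

variable {d : ℕ} {K : Set (EuclideanSpace ℝ (Fin d))}

/-- The Wills functional of a set in `ℝ^d`. -/
noncomputable def wills (K : Set (EuclideanSpace ℝ (Fin d))) : ℝ :=
  ∫ x, exp (-π * infDist x K ^ 2)

theorem exp_neg_infDist_sq_le {R η : ℝ} (hK : K.Nonempty) (hKR : K ⊆ closedBall 0 R)
    (hη : 0 < η) (x : EuclideanSpace ℝ (Fin d)) :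
    exp (-π * infDist x K ^ 2) ≤ exp (π * R ^ 2 / η) * exp (-(π / (1 + η)) * ‖x‖ ^ 2) := by
  have hR : 0 ≤ R := by
    obtain ⟨y, hy⟩ := hK
    exact (norm_nonneg y).trans (by simpa using hKR hy)
  have h1 : ‖x‖ ≤ infDist x K + R := by
    rw [← sub_le_iff_le_add]
    refine (le_infDist hK).mpr fun y hy => ?_
    have h2 : ‖y‖ ≤ R := by simpa using hKR hy
    have h3 := norm_sub_norm_le x y
    rw [dist_eq_norm]
    linarith
  have h0 : 0 ≤ infDist x K := infDist_nonneg
  have h4 : ‖x‖ ^ 2 ≤ (infDist x K + R) ^ 2 := pow_le_pow_left₀ (norm_nonneg x) h1 2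
  have h5 : ‖x‖ ^ 2 / (1 + η) ≤ infDist x K ^ 2 + R ^ 2 / η := by
    rw [div_le_iff₀ (by linarith)]
    have : (infDist x K ^ 2 + R ^ 2 / η) * (1 + η) - (infDist x K + R) ^ 2
        = (η * infDist x K - R) ^ 2 / η := by
      field_simp
      ring
    have : 0 ≤ (η * infDist x K - R) ^ 2 / η := by positivity
    linarith
  rw [← exp_add]
  refine exp_le_exp.mpr ?_
  have := mul_le_mul_of_nonneg_left h5 pi_pos.le
  have e : π * R ^ 2 / η + -(π / (1 + η)) * ‖x‖ ^ 2
    = π * (R ^ 2 / η) - π * (‖x‖ ^ 2 / (1 + η)) := by ring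
  rw [e]
  linarith

theorem integrable_exp_neg_mul_sq_norm {b : ℝ} (hb : 0 < b) :
    Integrable fun x : EuclideanSpace ℝ (Fin d) => exp (-b * ‖x‖ ^ 2) := by
  refine not_imp_comm.1 integral_undef ?_
  rw [GaussianFourier.integral_rexp_neg_mul_sq_norm hb]
  positivity

theorem integrable_exp_neg_infDist_sq (hK : K.Nonempty) (hKb : Bornology.IsBounded K) :
    Integrable fun x : EuclideanSpace ℝ (Fin d) => exp (-π * infDist x K ^ 2) := by
  obtain ⟨R, hR⟩ := hKb.subset_closedBall 0
  refine ((integrable_exp_neg_mul_sq_norm (d := d)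
    (show 0 < π / (1 + 1) by positivity)).const_mul (exp (π * R ^ 2 / 1))).mono'
    (by fun_prop) (Filter.Eventually.of_forall fun x => ?_)
  rw [norm_of_nonneg (exp_pos _).le]
  exact exp_neg_infDist_sq_le hK hR one_pos x

theorem log_wills_le {R η : ℝ} (hK : K.Nonempty) (hKR : K ⊆ closedBall 0 R) (hη : 0 < η)
    (hW : 0 < wills K) : log (wills K) ≤ π * R ^ 2 / η + d * η / 2 := by
  have hb : 0 < π / (1 + η) := by positivity
  have h1 : wills K ≤ exp (π * R ^ 2 / η) * (1 + η) ^ ((d : ℝ) / 2) := by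
    calc wills K ≤ ∫ x : EuclideanSpace ℝ (Fin d),
          exp (π * R ^ 2 / η) * exp (-(π / (1 + η)) * ‖x‖ ^ 2) :=
          integral_mono (integrable_exp_neg_infDist_sq hK (isBounded_closedBall.subset hKR))
            ((integrable_exp_neg_mul_sq_norm hb).const_mul _)
            fun x => exp_neg_infDist_sq_le hK hKR hη x
      _ = exp (π * R ^ 2 / η) * (1 + η) ^ ((d : ℝ) / 2) := by
          rw [integral_const_mul, GaussianFourier.integral_rexp_neg_mul_sq_norm hb,
            finrank_euclideanSpace_fin]
          congr 2
          field_simp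
  refine (log_le_log hW h1).trans ?_
  rw [log_mul (exp_pos _).ne' (by positivity), log_exp, log_rpow (by linarith)]
  have := log_le_sub_one_of_pos (show 0 < 1 + η by linarith)
  have : (d : ℝ) / 2 * log (1 + η) ≤ d / 2 * η :=
    mul_le_mul_of_nonneg_left (by linarith) (by positivity)
  linarith

theorem one_le_wills (hK : (0 : EuclideanSpace ℝ (Fin d)) ∈ K) (hKb : Bornology.IsBounded K) :
    1 ≤ wills K := by
  have h : ∫ x : EuclideanSpace ℝ (Fin d), exp (-π * ‖x‖ ^ 2) = 1 := by
    rw [GaussianFourier.integral_rexp_neg_mul_sq_norm pi_pos, div_self pi_ne_zero, one_rpow]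
  rw [← h]
  refine integral_mono (integrable_exp_neg_mul_sq_norm pi_pos)
    (integrable_exp_neg_infDist_sq ⟨0, hK⟩ hKb) fun x => exp_le_exp.mpr ?_
  have h1 : infDist x K ≤ ‖x‖ := by simpa using infDist_le_dist_of_mem (x := x) hK
  have h2 : infDist x K ^ 2 ≤ ‖x‖ ^ 2 := pow_le_pow_left₀ infDist_nonneg h1 2
  nlinarith [pi_pos]

theorem ofReal_wills (hK : K.Nonempty) (hKb : Bornology.IsBounded K) :
    ENNReal.ofReal (wills K) = ∫⁻ x, ENNReal.ofReal (exp (-π * infDist x K ^ 2)) :=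
  ofReal_integral_eq_lintegral_ofReal (integrable_exp_neg_infDist_sq hK hKb)
    (Filter.Eventually.of_forall fun _ => (exp_pos _).le)

theorem ofReal_exp_rpow_mul_rpow {a b : ℝ} (ha : 0 ≤ a) (hb : 0 ≤ b) (u v : ℝ) :
    ENNReal.ofReal (exp u) ^ a * ENNReal.ofReal (exp v) ^ b
      = ENNReal.ofReal (exp (a * u + b * v)) := by
  rw [ENNReal.ofReal_rpow_of_nonneg (exp_pos _).le ha,
    ENNReal.ofReal_rpow_of_nonneg (exp_pos _).le hb, ← ENNReal.ofReal_mul (by positivity),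
    ← exp_mul, ← exp_mul, ← exp_add, mul_comm a, mul_comm b]

theorem infDist_sq_le_of_convex (hKc : IsCompact K) (hKv : Convex ℝ K) (hK : K.Nonempty)
    {a b s t : ℝ} (ha : 0 ≤ a) (hb : 0 ≤ b) (hab : a + b = 1) (hs : 0 ≤ s) (ht : 0 ≤ t)
    (x y : EuclideanSpace ℝ (Fin d)) :
    infDist (a • x + b • y) ((a * s + b * t) • K) ^ 2
      ≤ a * infDist x (s • K) ^ 2 + b * infDist y (t • K) ^ 2 := by
  obtain ⟨p, hp, hxp⟩ := (hKc.smul s).exists_infDist_eq_dist hK.smul_set x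
  obtain ⟨q, hq, hyq⟩ := (hKc.smul t).exists_infDist_eq_dist hK.smul_set y
  have hmem : a • p + b • q ∈ (a * s + b * t) • K := by
    rw [hKv.add_smul (by positivity) (by positivity), mul_smul, mul_smul]
    exact Set.add_mem_add (Set.smul_mem_smul_set hp) (Set.smul_mem_smul_set hq)
  have h1 : infDist (a • x + b • y) ((a * s + b * t) • K) ≤ a * dist x p + b * dist y q := by
    refine (infDist_le_dist_of_mem hmem).trans ?_
    rw [dist_eq_norm, dist_eq_norm, dist_eq_norm]
    have : a • x + b • y - (a • p + b • q) = a • (x - p) + b • (y - q) := by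
      simp only [smul_sub]; abel
    rw [this]
    refine (norm_add_le _ _).trans ?_
    rw [norm_smul, norm_smul, norm_of_nonneg ha, norm_of_nonneg hb]
  rw [hxp, hyq]
  refine (pow_le_pow_left₀ infDist_nonneg h1 2).trans ?_
  have h2 := (convexOn_pow (𝕜 := ℝ) 2).2 (x := dist x p) (y := dist y q)
    dist_nonneg dist_nonneg ha hb hab
  simpa using h2

theorem concaveOn_log_wills (hKc : IsCompact K) (hKv : Convex ℝ K)
    (h0 : (0 : EuclideanSpace ℝ (Fin d)) ∈ K) :
    ConcaveOn ℝ (Set.Ioi 0) fun t : ℝ => log (wills (t • K)) := by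
  have hne : ∀ t : ℝ, (t • K).Nonempty := fun t => Set.Nonempty.smul_set ⟨0, h0⟩
  have hbd : ∀ t : ℝ, Bornology.IsBounded (t • K) := fun t => (hKc.smul t).isBounded
  have hpos : ∀ t : ℝ, 0 < wills (t • K) := fun t => one_pos.trans_le
    (one_le_wills (Set.zero_mem_smul_set h0) (hbd t))
  rw [concaveOn_iff_forall_pos]
  refine ⟨convex_Ioi 0, fun s hs t ht a b ha hb hab => ?_⟩
  have key := prekopaLeindler_euclideanSpace d a b ha hb hab
    (fun x => ENNReal.ofReal (exp (-π * infDist x (s • K) ^ 2)))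
    (fun x => ENNReal.ofReal (exp (-π * infDist x (t • K) ^ 2)))
    (fun x => ENNReal.ofReal (exp (-π * infDist x ((a * s + b * t) • K) ^ 2)))
    (by fun_prop) (by fun_prop) (by fun_prop) (fun x y => by
      rw [ofReal_exp_rpow_mul_rpow ha.le hb.le]
      refine ENNReal.ofReal_le_ofReal (exp_le_exp.mpr ?_)
      have := infDist_sq_le_of_convex hKc hKv ⟨0, h0⟩ ha.le hb.le hab (Set.mem_Ioi.mp hs).le
        (Set.mem_Ioi.mp ht).le x y
      nlinarith [pi_pos])
  rw [← ofReal_wills (hne _) (hbd _), ← ofReal_wills (hne _) (hbd _),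
    ← ofReal_wills (hne _) (hbd _), ← exp_log (hpos s), ← exp_log (hpos t),
    ofReal_exp_rpow_mul_rpow ha.le hb.le, ENNReal.ofReal_le_ofReal_iff (hpos _).le,
    ← le_log_iff_exp_le (hpos _)] at key
  exact key

theorem infDist_sq_ge_of_subset_closedBall {R : ℝ} (hKc : IsCompact K) (hK : K.Nonempty)
    (hKR : K ⊆ closedBall 0 R) {a b : ℝ} (ha : 0 ≤ a) (hb : 0 ≤ b) (hab : a + b = 1) (s t : ℝ)
    (x : EuclideanSpace ℝ (Fin d)) :
    a * (infDist x (s • K) ^ 2 - R ^ 2 * s ^ 2) + b * (infDist x (t • K) ^ 2 - R ^ 2 * t ^ 2)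
      ≤ infDist x ((a * s + b * t) • K) ^ 2 - R ^ 2 * (a * s + b * t) ^ 2 := by
  obtain ⟨_, ⟨y, hy, rfl⟩, hxy⟩ :=
    (hKc.smul (a * s + b * t)).exists_infDist_eq_dist hK.smul_set x
  have hd : ∀ r : ℝ, dist x (r • y) ^ 2
      = ‖x‖ ^ 2 - 2 * r * inner ℝ x y + r ^ 2 * ‖y‖ ^ 2 := fun r => by
    rw [dist_eq_norm, norm_sub_sq_real, norm_smul, inner_smul_right, mul_pow, norm_eq_abs, sq_abs]
    ring
  have hle : ∀ r : ℝ, infDist x (r • K) ^ 2 ≤ dist x (r • y) ^ 2 := fun r =>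
    pow_le_pow_left₀ infDist_nonneg (infDist_le_dist_of_mem (Set.smul_mem_smul_set hy)) 2
  have hyR : ‖y‖ ^ 2 ≤ R ^ 2 := pow_le_pow_left₀ (norm_nonneg y) (by simpa using hKR hy) 2
  have hsimp : (fun z => (a * s + b * t) • z) y = (a * s + b * t) • y := rfl
  rw [hxy, hsimp, hd]
  have h1 := mul_le_mul_of_nonneg_left ((hle s).trans_eq (hd s)) ha
  have h2 := mul_le_mul_of_nonneg_left ((hle t).trans_eq (hd t)) hb
  have h3 : 0 ≤ (R ^ 2 - ‖y‖ ^ 2) * (a * b * (s - t) ^ 2) :=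
    mul_nonneg (by linarith) (by positivity)
  obtain rfl : b = 1 - a := by linarith
  nlinarith [h1, h2, h3]

theorem convexOn_log_wills_add {R : ℝ} (hKc : IsCompact K)
    (h0 : (0 : EuclideanSpace ℝ (Fin d)) ∈ K) (hKR : K ⊆ closedBall 0 R) :
    ConvexOn ℝ (Set.Ioi 0) fun t : ℝ => log (wills (t • K)) + π * R ^ 2 * t ^ 2 := by
  have hne : ∀ t : ℝ, (t • K).Nonempty := fun t => Set.Nonempty.smul_set ⟨0, h0⟩
  have hbd : ∀ t : ℝ, Bornology.IsBounded (t • K) := fun t => (hKc.smul t).isBounded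
  have hpos : ∀ t : ℝ, 0 < wills (t • K) := fun t => one_pos.trans_le
    (one_le_wills (Set.zero_mem_smul_set h0) (hbd t))
  refine ⟨convex_Ioi 0, fun s _ t _ a b ha hb hab => ?_⟩
  simp only [smul_eq_mul]
  set c : ℝ := a * (π * R ^ 2 * s ^ 2) + b * (π * R ^ 2 * t ^ 2)
    - π * R ^ 2 * (a * s + b * t) ^ 2 with hc
  have h1 : ENNReal.ofReal (wills ((a * s + b * t) • K)) ≤ ENNReal.ofReal (exp c) *
      (ENNReal.ofReal (wills (s • K)) ^ a * ENNReal.ofReal (wills (t • K)) ^ b) := by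
    rw [ofReal_wills (hne _) (hbd _), ofReal_wills (hne _) (hbd _),
      ofReal_wills (hne _) (hbd _)]
    refine le_trans ?_ (mul_le_mul_right (ENNReal.lintegral_mul_norm_pow_le
      (by fun_prop) (by fun_prop) ha hb hab) _)
    rw [← lintegral_const_mul _ (by fun_prop)]
    refine lintegral_mono fun x => ?_
    simp only
    rw [ofReal_exp_rpow_mul_rpow ha hb, ← ENNReal.ofReal_mul (exp_pos _).le, ← exp_add]
    refine ENNReal.ofReal_le_ofReal (exp_le_exp.mpr ?_)
    have := infDist_sq_ge_of_subset_closedBall hKc ⟨0, h0⟩ hKR ha hb hab s t x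
    rw [hc]
    nlinarith [pi_pos]
  rw [← exp_log (hpos s), ← exp_log (hpos t), ofReal_exp_rpow_mul_rpow ha hb,
    ← ENNReal.ofReal_mul (exp_pos _).le, ← exp_add,
    ENNReal.ofReal_le_ofReal_iff (exp_pos _).le, ← log_le_iff_le_exp (hpos _)] at h1
  rw [hc] at h1
  linarith

theorem wills_smul {t : ℝ} (ht : 0 < t) :
    wills (t • K) = t ^ d * ∫ x, exp (-π * (t ^ 2 * infDist x K ^ 2)) := by
  have h := Measure.integral_comp_smul (volume : Measure (EuclideanSpace ℝ (Fin d)))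
    (fun x => exp (-π * infDist x (t • K) ^ 2)) t
  simp only [infDist_smul₀ ht.ne', norm_of_nonneg ht.le, mul_pow, finrank_euclideanSpace_fin] at h
  rw [h, abs_of_pos (by positivity), smul_eq_mul, mul_inv_cancel_left₀ (by positivity)]
  rfl

end Wills

section MomentGeneratingFunction

theorem isTightMeasureSet_of_integral_exp_le (C : ℝ) :
    IsTightMeasureSet {((μ : ProbabilityMeasure ℝ) : Measure ℝ) | μ ∈ {μ : ProbabilityMeasure ℝ |
      Integrable (fun x => exp (1 * x)) (μ : Measure ℝ) ∧
      Integrable (fun x => exp (-1 * x)) (μ : Measure ℝ) ∧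
      ∫ x, exp (1 * x) ∂(μ : Measure ℝ) ≤ C ∧ ∫ x, exp (-1 * x) ∂(μ : Measure ℝ) ≤ C}} := by
  rw [isTightMeasureSet_iff_exists_isCompact_measure_compl_le]
  intro ε hε
  have hlim : Filter.Tendsto (fun r : ℝ => ENNReal.ofReal (2 * (exp (-r) * C))) Filter.atTop
      (nhds 0) := by
    have h : Filter.Tendsto (fun r : ℝ => 2 * (exp (-r) * C)) Filter.atTop (nhds (2 * (0 * C))) :=
      ((tendsto_exp_neg_atTop_nhds_zero).mul_const C).const_mul 2
    have h2 := ENNReal.tendsto_ofReal h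
    simpa using h2
  obtain ⟨r, hr⟩ := (hlim.eventually_lt_const hε).exists
  refine ⟨Set.Icc (-r) r, isCompact_Icc, ?_⟩
  rintro _ ⟨μ, ⟨hi1, hi2, hC1, hC2⟩, rfl⟩
  refine le_trans ?_ hr.le
  have h1 := measure_ge_le_exp_mul_mgf (μ := (μ : Measure ℝ)) (X := fun x => x) (t := 1) r
    zero_le_one hi1
  have h2 := measure_le_le_exp_mul_mgf (μ := (μ : Measure ℝ)) (X := fun x => x) (t := -1) (-r)
    (by norm_num) hi2
  simp only [mgf] at h1 h2
  have hsub : (Set.Icc (-r) r)ᶜ ⊆ {x : ℝ | r ≤ x} ∪ {x : ℝ | x ≤ -r} := by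
    intro x hx
    by_contra hcon
    simp only [Set.mem_union, Set.mem_ofPred_eq, not_or, not_le] at hcon
    exact hx ⟨hcon.2.le, hcon.1.le⟩
  have h3 : (μ : Measure ℝ).real (Set.Icc (-r) r)ᶜ ≤ 2 * (exp (-r) * C) := by
    refine (measureReal_mono hsub).trans ((measureReal_union_le _ _).trans ?_)
    have e1 : exp (-1 * r) = exp (-r) := by ring_nf
    have e2 : exp (- -1 * -r) = exp (-r) := by ring_nf
    rw [e1] at h1
    rw [e2] at h2
    have := mul_le_mul_of_nonneg_left hC1 (exp_pos (-r)).le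
    have := mul_le_mul_of_nonneg_left hC2 (exp_pos (-r)).le
    linarith
  rw [← ofReal_measureReal]
  exact ENNReal.ofReal_le_ofReal h3

/-- The bounded continuous function `x ↦ min (exp (t * x)) N`. -/
noncomputable def expTrunc (t : ℝ) (N : ℕ) : BoundedContinuousFunction ℝ ℝ :=
  BoundedContinuousFunction.ofNormedAddCommGroup (fun x => min (exp (t * x)) N) (by fun_prop) N
    fun x => by
      rw [norm_of_nonneg (le_min (exp_pos _).le (Nat.cast_nonneg N))]
      exact min_le_right _ _

theorem expTrunc_apply (t : ℝ) (N : ℕ) (x : ℝ) : expTrunc t N x = min (exp (t * x)) N := rfl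

theorem integral_exp_sub_le_integral_expTrunc {μ : Measure ℝ} [IsProbabilityMeasure μ] {t : ℝ}
    {N : ℕ} (hN : 0 < N) (h1 : Integrable (fun x => exp (t * x)) μ)
    (h2 : Integrable (fun x => exp (2 * t * x)) μ) :
    ∫ x, exp (t * x) ∂μ - (∫ x, exp (2 * t * x) ∂μ) / N ≤ ∫ x, expTrunc t N x ∂μ := by
  rw [← integral_div, ← integral_sub h1 (h2.div_const _)]
  refine integral_mono (h1.sub (h2.div_const _)) ((expTrunc t N).integrable μ) fun x => ?_
  rw [expTrunc_apply]
  have hN' : (0 : ℝ) < N := by exact_mod_cast hN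
  have e : exp (2 * t * x) = exp (t * x) * exp (t * x) := by rw [← exp_add]; ring_nf
  have hp := exp_pos (t * x)
  simp only [e]
  rcases le_total (exp (t * x)) N with h | h
  · rw [min_eq_left h]
    have : 0 ≤ exp (t * x) * exp (t * x) / N := by positivity
    linarith
  · have : exp (t * x) ≤ exp (t * x) * exp (t * x) / N := by
      rw [le_div_iff₀ hN']
      exact mul_le_mul_of_nonneg_left h hp.le
    exact le_min (by linarith) (by linarith)

theorem tendsto_expTrunc (t x : ℝ) :
    Filter.Tendsto (fun N : ℕ => expTrunc t N x) Filter.atTop (nhds (exp (t * x))) := by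
  refine tendsto_const_nhds.congr' ?_
  filter_upwards [Filter.eventually_ge_atTop ⌈exp (t * x)⌉₊] with N hN
  rw [expTrunc_apply, min_eq_left ((Nat.le_ceil _).trans (by exact_mod_cast hN))]

theorem integrable_exp_of_integral_expTrunc_le {μ : Measure ℝ} [IsProbabilityMeasure μ] {t C : ℝ}
    (h : ∀ N, ∫ x, expTrunc t N x ∂μ ≤ C) : Integrable (fun x => exp (t * x)) μ := by
  refine ⟨by fun_prop, ?_⟩
  rw [hasFiniteIntegral_iff_ofReal (Filter.Eventually.of_forall fun _ => (exp_pos _).le)]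
  refine lt_of_le_of_lt ?_ (ENNReal.ofReal_lt_top (r := C))
  refine le_of_tendsto' (lintegral_tendsto_of_tendsto_of_monotone
    (f := fun N : ℕ => fun x => ENNReal.ofReal (expTrunc t N x))
    (fun N => (expTrunc t N).continuous.measurable.ennreal_ofReal.aemeasurable)
    (Filter.Eventually.of_forall fun x M N hMN => ENNReal.ofReal_le_ofReal ?_)
    (Filter.Eventually.of_forall fun x => ENNReal.tendsto_ofReal (tendsto_expTrunc t x)))
    fun N => ?_
  · exact min_le_min_left _ (by exact_mod_cast hMN)
  · rw [← ofReal_integral_eq_lintegral_ofReal ((expTrunc t N).integrable μ)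
      (Filter.Eventually.of_forall fun x => le_min (exp_pos _).le (Nat.cast_nonneg N))]
    exact ENNReal.ofReal_le_ofReal (h N)

theorem tendsto_integral_expTrunc {μ : Measure ℝ} [IsProbabilityMeasure μ] {t : ℝ}
    (h : Integrable (fun x => exp (t * x)) μ) :
    Filter.Tendsto (fun N : ℕ => ∫ x, expTrunc t N x ∂μ) Filter.atTop
      (nhds (∫ x, exp (t * x) ∂μ)) := by
  refine tendsto_integral_of_dominated_convergence _
    (fun N => (expTrunc t N).continuous.aestronglyMeasurable) h (fun N =>
      Filter.Eventually.of_forall fun x => ?_)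
    (Filter.Eventually.of_forall fun x => tendsto_expTrunc t x)
  rw [expTrunc_apply, norm_of_nonneg (le_min (exp_pos _).le (Nat.cast_nonneg N))]
  exact min_le_left _ _

/-- Weak convergence and convergence of moment generating functions identify the moment
generating function of the limit. -/
theorem integral_exp_eq_of_tendsto {ι : Type*} {l : Filter ι} [l.NeBot]
    {μ : ι → ProbabilityMeasure ℝ} {ρ : ProbabilityMeasure ℝ} {M : ℝ → ℝ}
    (hint : ∀ t : ℝ, ∀ᶠ n in l, Integrable (fun x => exp (t * x)) (μ n : Measure ℝ))
    (hlim : ∀ t : ℝ, Filter.Tendsto (fun n => ∫ x, exp (t * x) ∂(μ n : Measure ℝ)) l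
      (nhds (M t)))
    (hρ : Filter.Tendsto μ l (nhds ρ)) (t : ℝ) :
    ∫ x, exp (t * x) ∂(ρ : Measure ℝ) = M t := by
  have hw := fun N => (ProbabilityMeasure.tendsto_iff_forall_integral_tendsto.mp hρ) (expTrunc t N)
  have hle : ∀ N, ∫ x, expTrunc t N x ∂(ρ : Measure ℝ) ≤ M t := fun N =>
    le_of_tendsto_of_tendsto (hw N) (hlim t) (by
      filter_upwards [hint t] with n hn
      exact integral_mono ((expTrunc t N).integrable _) hn fun x => min_le_left _ _)
  have hge : ∀ N : ℕ, 0 < N → M t - M (2 * t) / N ≤ ∫ x, expTrunc t N x ∂(ρ : Measure ℝ) :=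
    fun N hN => le_of_tendsto_of_tendsto ((hlim t).sub ((hlim (2 * t)).div_const _)) (hw N) (by
      filter_upwards [hint t, hint (2 * t)] with n hn hn2
      exact integral_exp_sub_le_integral_expTrunc hN hn hn2)
  have hT := tendsto_integral_expTrunc (integrable_exp_of_integral_expTrunc_le hle)
  refine le_antisymm (le_of_tendsto' hT hle) ?_
  have h0 : Filter.Tendsto (fun N : ℕ => M t - M (2 * t) / N) Filter.atTop (nhds (M t - 0)) :=
    tendsto_const_nhds.sub (tendsto_const_div_atTop_nhds_zero_nat _)
  rw [sub_zero] at h0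
  refine le_of_tendsto_of_tendsto h0 hT ?_
  filter_upwards [Filter.eventually_gt_atTop 0] with N hN using hge N hN

/-- Curtiss' theorem: convergence of moment generating functions on `ℝ` implies weak
convergence. -/
theorem tendsto_of_tendsto_integral_exp {μ : ℕ → ProbabilityMeasure ℝ} {ν : ProbabilityMeasure ℝ}
    (hν : ∀ t : ℝ, Integrable (fun x => exp (t * x)) (ν : Measure ℝ))
    (hint : ∀ t : ℝ, ∀ᶠ n in Filter.atTop, Integrable (fun x => exp (t * x)) (μ n : Measure ℝ))
    (hlim : ∀ t : ℝ, Filter.Tendsto (fun n => ∫ x, exp (t * x) ∂(μ n : Measure ℝ)) Filter.atTop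
      (nhds (∫ x, exp (t * x) ∂(ν : Measure ℝ)))) :
    Filter.Tendsto μ Filter.atTop (nhds ν) := by
  set C := max (∫ x, exp (1 * x) ∂(ν : Measure ℝ)) (∫ x, exp (-1 * x) ∂(ν : Measure ℝ)) + 1
  refine (isCompact_closure_of_isTightMeasureSet
    (isTightMeasureSet_of_integral_exp_le C)).tendsto_nhds_of_unique_mapClusterPt ?_ ?_
  · filter_upwards [hint 1, hint (-1),
      (hlim 1).eventually_le_const ((le_max_left _ _).trans_lt (lt_add_one _)),
      (hlim (-1)).eventually_le_const ((le_max_right _ _).trans_lt (lt_add_one _))]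
      with n h1 h2 h3 h4 using subset_closure ⟨h1, h2, h3, h4⟩
  · intro ρ _ hρ
    obtain ⟨U, hU, hUρ⟩ := mapClusterPt_iff_ultrafilter.mp hρ
    have hmgf := integral_exp_eq_of_tendsto (fun t => (hint t).filter_mono hU)
      (fun t => (hlim t).mono_left hU) hUρ
    have hset : integrableExpSet id (ν : Measure ℝ) = Set.univ := by
      ext t
      simpa [integrableExpSet] using hν t
    have heq := eqOn_complexMGF_of_mgf (X := id) (Y := id) (μ := (ν : Measure ℝ))
      (μ' := (ρ : Measure ℝ)) (by
        ext t
        simpa [mgf] using (hmgf t).symm)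
    rw [hset] at heq
    refine Subtype.ext (Measure.ext_of_complexMGF_id_eq (μ := (ν : Measure ℝ))
      (μ' := (ρ : Measure ℝ)) (funext fun z => heq (by simp))).symm

end MomentGeneratingFunction

section CumulantGeneratingFunction

variable {Ω : Type*} [MeasurableSpace Ω] {P : Measure Ω} {V : Ω → ℝ}

theorem mem_interior_integrableExpSet_of_lt_one
    (hint : ∀ θ < 1, Integrable (fun ω => exp (θ * V ω)) P) {θ : ℝ} (hθ : θ < 1) :
    θ ∈ interior (integrableExpSet V P) :=
  interior_maximal (fun θ hθ => hint θ hθ) isOpen_Iio (Set.mem_Iio.mpr hθ)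

/-- If `cgf V` differs from the cumulant generating function of a Gamma distribution of shape
`δ / 2` by `G (√(1 - θ)) - G 1`, where `G` is concave and `c`-semiconvex, then `cgf V` is close to
that of the Gamma distribution, after centering. -/
theorem abs_cgf_sub_le [IsProbabilityMeasure P]
    (hint : ∀ θ < 1, Integrable (fun ω => exp (θ * V ω)) P) {G : ℝ → ℝ} {δ c : ℝ}
    (hcgf : ∀ θ < 1, cgf V P θ = G √(1 - θ) - δ / 2 * log (1 - θ) - G 1)
    (hconc : ConcaveOn ℝ (Set.Ioi 0) G)
    (hconv : ConvexOn ℝ (Set.Ioi 0) fun t => G t + c * t ^ 2)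
    (hG1 : 0 ≤ G (1 / 2)) (hG2 : 0 ≤ G 2) {θ : ℝ} (hθ : θ < 1) (hc : 0 ≤ c) :
    |cgf V P θ - θ * P[V] - δ / 2 * (-log (1 - θ) - θ)| ≤ (c + G 1) * θ ^ 2 := by
  have h0 := mem_interior_integrableExpSet_of_lt_one hint zero_lt_one
  set m := P[V] with hm
  set D := δ - 2 * m with hD
  have hcd : HasDerivAt (cgf V P) m 0 := by
    have h := (analyticAt_cgf h0).differentiableAt.hasDerivAt
    rwa [deriv_cgf_zero h0, probReal_univ, div_one] at h
  have hGd : HasDerivAt G D 1 := by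
    have h1 : HasDerivAt (fun t : ℝ => 1 - t ^ 2) (-2) 1 := by
      simpa using ((hasDerivAt_id (1 : ℝ)).pow 2).const_sub 1
    have hcd' : HasDerivAt (cgf V P) m ((fun t : ℝ => 1 - t ^ 2) 1) := by
      norm_num
      exact hcd
    have h2 : HasDerivAt (fun t : ℝ => cgf V P (1 - t ^ 2)) (m * -2) 1 :=
      HasDerivAt.comp (h₂ := cgf V P) (h := fun t => 1 - t ^ 2) 1 hcd' h1
    have h3 : HasDerivAt (fun t : ℝ => cgf V P (1 - t ^ 2) + δ * log t + G 1)
        (m * -2 + δ * 1⁻¹) 1 :=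
      (h2.add ((hasDerivAt_log one_ne_zero).const_mul δ)).add_const _
    have h4 : m * -2 + δ * 1⁻¹ = D := by rw [hD]; ring
    rw [h4] at h3
    refine h3.congr_of_eventuallyEq ?_
    filter_upwards [lt_mem_nhds (zero_lt_one' ℝ)] with t ht
    have ht2 : 1 - t ^ 2 < 1 := by nlinarith
    rw [hcgf _ ht2]
    simp only [sub_sub_cancel, sqrt_sq ht.le, log_pow]
    push_cast
    ring
  have hGd2 : HasDerivAt (fun t => G t + c * t ^ 2) (D + 2 * c) 1 := by
    have h := hGd.add (((hasDerivAt_id (1 : ℝ)).pow 2).const_mul c)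
    have e : D + c * (((2 : ℕ) : ℝ) * id (1 : ℝ) ^ (2 - 1) * 1) = D + 2 * c := by
      simp; ring
    rw [e] at h
    exact h
  have hmem1 : (1 : ℝ) ∈ Set.Ioi (0 : ℝ) := by simp
  have hup : ∀ t, 0 < t → G t ≤ G 1 + D * (t - 1) := by
    intro t ht
    rcases lt_trichotomy t 1 with h | h | h
    · have := hconc.le_slope_of_hasDerivAt (x := t) (y := 1) ht hmem1 h hGd
      rw [slope_def_field, le_div_iff₀ (by linarith)] at this
      linarith
    · simp [h]
    · have := hconc.slope_le_of_hasDerivAt (x := 1) (y := t) hmem1 ht h hGd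
      rw [slope_def_field, div_le_iff₀ (by linarith)] at this
      linarith
  have hlow : ∀ t, 0 < t → G 1 + D * (t - 1) - c * (t - 1) ^ 2 ≤ G t := by
    intro t ht
    rcases lt_trichotomy t 1 with h | h | h
    · have := hconv.slope_le_of_hasDerivAt (x := t) (y := 1) ht hmem1 h hGd2
      rw [slope_def_field, div_le_iff₀ (by linarith)] at this
      linarith
    · simp [h]
    · have := hconv.le_slope_of_hasDerivAt (x := 1) (y := t) hmem1 ht h hGd2
      rw [slope_def_field, le_div_iff₀ (by linarith)] at this
      linarith
  have hD1 : D ≤ 2 * G 1 := by linarith [hup (1 / 2) (by norm_num)]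
  have hD2 : -(2 * G 1) ≤ D := by linarith [hup 2 (by norm_num)]
  set τ := √(1 - θ) with hτ
  have hτ0 : 0 < τ := sqrt_pos.mpr (by linarith)
  have hτ2 : τ ^ 2 = 1 - θ := sq_sqrt (by linarith)
  have hθτ : θ = (1 - τ) * (1 + τ) := by linarith
  have heq : cgf V P θ - θ * m - δ / 2 * (-log (1 - θ) - θ)
      = (G τ - G 1 - D * (τ - 1)) - D * (τ - 1) ^ 2 / 2 := by
    rw [hcgf θ hθ, ← hτ, hD, hθτ]
    ring
  have hsq : (τ - 1) ^ 2 ≤ θ ^ 2 := by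
    rw [hθτ, mul_pow]
    nlinarith [sq_nonneg (1 - τ)]
  have hG1' : 0 ≤ G 1 := by linarith
  have hu := hup τ hτ0
  have hl := hlow τ hτ0
  have hs := sq_nonneg (τ - 1)
  have hfin : (c + G 1) * (τ - 1) ^ 2 ≤ (c + G 1) * θ ^ 2 :=
    mul_le_mul_of_nonneg_left hsq (by linarith)
  have hcs := mul_nonneg hc hs
  have hDs1 := mul_le_mul_of_nonneg_right hD1 hs
  have hDs2 := mul_le_mul_of_nonneg_right hD2 hs
  rw [heq, abs_le]
  constructor <;> linarith

theorem cgf_sub_const [IsProbabilityMeasure P] {θ : ℝ}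
    (hV : Integrable (fun ω => exp (θ * V ω)) P)
    (m : ℝ) : cgf (fun ω => V ω - m) P θ = cgf V P θ - θ * m := by
  have h : mgf (fun ω => V ω - m) P θ = mgf V P θ * exp (-(θ * m)) := by
    rw [mgf, mgf, ← integral_mul_const]
    congr with ω
    rw [← exp_add]
    ring_nf
  rw [cgf, cgf, h, log_mul (mgf_pos hV).ne' (exp_pos _).ne', log_exp]
  ring

theorem abs_neg_log_one_sub_sub_le {x : ℝ} (hx : |x| ≤ 1 / 2) :
    |-log (1 - x) - x - x ^ 2 / 2| ≤ 2 * |x| ^ 3 := by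
  have h := abs_log_sub_add_sum_range_le (lt_of_le_of_lt hx (by norm_num)) 2
  have h2 : |x| ^ (2 + 1) / (1 - |x|) ≤ 2 * |x| ^ 3 := by
    rw [div_le_iff₀ (by linarith)]
    rw [show 2 + 1 = 3 from rfl]
    linarith [mul_nonneg (pow_nonneg (abs_nonneg x) 3) (by linarith : 0 ≤ 1 - 2 * |x|)]
  refine le_trans (le_of_eq ?_) (h.trans h2)
  rw [← abs_neg]
  simp [Finset.sum_range_succ]
  ring_nf

theorem abs_variance_sub_le [IsProbabilityMeasure P]
    (hint : ∀ θ < 1, Integrable (fun ω => exp (θ * V ω)) P) {δ C : ℝ}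
    (h : ∀ θ < 1, |cgf V P θ - θ * P[V] - δ / 2 * (-log (1 - θ) - θ)| ≤ C * θ ^ 2) :
    |variance V P - δ / 2| ≤ 2 * C := by
  set m := P[V] with hm
  set Y : Ω → ℝ := fun ω => V ω - m with hY
  have h0 := mem_interior_integrableExpSet_of_lt_one hint zero_lt_one
  have hVi : Integrable V P := by
    simpa using integrable_pow_of_mem_interior_integrableExpSet h0 1
  have hintY : ∀ θ < 1, Integrable (fun ω => exp (θ * Y ω)) P := fun θ hθ => by
    refine ((hint θ hθ).mul_const (exp (-(θ * m)))).congr (Filter.Eventually.of_forall fun ω => ?_)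
    simp only [hY, ← exp_add]
    ring_nf
  have hYm : P[Y] = 0 := by
    rw [hY, integral_sub hVi (integrable_const _)]
    simp [hm]
  have hY0 := mem_interior_integrableExpSet_of_lt_one hintY zero_lt_one
  have hvar : iteratedDeriv 2 (cgf Y P) 0 = variance V P := by
    rw [iteratedDeriv_two_cgf_eq_integral hY0, deriv_cgf_zero hY0, hYm,
      variance_eq_integral hVi.aemeasurable]
    simp [hY, hm]
  have hcont : ContinuousAt (iteratedDeriv 2 (cgf Y P)) 0 := by
    rw [iteratedDeriv_eq_iterate]
    exact (AnalyticAt.iterated_deriv (analyticAt_cgf hY0) 2).continuousAt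
  have key : ∀ n : ℕ, ∃ u ∈ Set.Ioo (0 : ℝ) (1 / (n + 2)),
      |iteratedDeriv 2 (cgf Y P) u - δ / 2| ≤ 2 * C + 2 * |δ| * (1 / (n + 2)) := by
    intro n
    set t : ℝ := 1 / (n + 2) with ht
    have ht0 : 0 < t := by positivity
    have ht1 : t ≤ 1 / 2 := by
      rw [ht]
      exact one_div_le_one_div_of_le (by norm_num) (by linarith [n.cast_nonneg (α := ℝ)])
    obtain ⟨u, hu, hcu⟩ := exists_cgf_eq_iteratedDeriv_two_cgf_mul ht0 hYm
      (fun θ hθ => mem_interior_integrableExpSet_of_lt_one hintY (by linarith [hθ.2]))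
    refine ⟨u, hu, ?_⟩
    have h1 := h t (by linarith)
    rw [← cgf_sub_const (hint t (by linarith)), hcu] at h1
    have h2 := abs_neg_log_one_sub_sub_le (x := t) (by rwa [abs_of_pos ht0])
    rw [abs_of_pos ht0] at h2
    set L := -log (1 - t) - t
    set v := iteratedDeriv 2 (cgf Y P) u
    have h3 : |δ / 2 * (L - t ^ 2 / 2)| ≤ |δ| * t ^ 3 := by
      rw [abs_mul, abs_div, abs_two]
      have := mul_le_mul_of_nonneg_left h2 (abs_nonneg δ)
      linarith
    have h4 : |(v - δ / 2) * (t ^ 2 / 2)| ≤ C * t ^ 2 + |δ| * t ^ 3 := by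
      have e : (v - δ / 2) * (t ^ 2 / 2)
          = (v * t ^ 2 / 2 - δ / 2 * L) + δ / 2 * (L - t ^ 2 / 2) := by ring
      rw [e]
      exact (abs_add_le _ _).trans (add_le_add h1 h3)
    rw [abs_mul, abs_of_pos (show 0 < t ^ 2 / 2 by positivity)] at h4
    have h5 : |v - δ / 2| * (t ^ 2 / 2) ≤ (2 * C + 2 * |δ| * t) * (t ^ 2 / 2) :=
      h4.trans_eq (by ring)
    exact le_of_mul_le_mul_right h5 (by positivity)
  choose u hu hub using key
  have hlim : Filter.Tendsto (fun n : ℕ => 1 / ((n : ℝ) + 2)) Filter.atTop (nhds 0) :=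
    tendsto_const_nhds.div_atTop
      (Filter.tendsto_atTop_add_const_right _ _ tendsto_natCast_atTop_atTop)
  have hul : Filter.Tendsto u Filter.atTop (nhds 0) :=
    tendsto_of_tendsto_of_tendsto_of_le_of_le tendsto_const_nhds hlim
      (fun n => (hu n).1.le) fun n => (hu n).2.le
  have h1 := ((hcont.tendsto.comp hul).sub_const (δ / 2)).abs
  have h2 := (hlim.const_mul (2 * |δ|)).const_add (2 * C)
  rw [mul_zero, add_zero] at h2
  rw [← hvar]
  exact le_of_tendsto_of_tendsto' h1 h2 hub

end CumulantGeneratingFunction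

section HadwigerWills

variable {d : ℕ} {K : Set (EuclideanSpace ℝ (Fin d))} {x₀ : EuclideanSpace ℝ (Fin d)}

theorem wills_sqrt_smul_image_sub {s : ℝ} (hs : 0 < s) :
    wills (√s • ((fun x => x - x₀) '' K)) = √s ^ d * ∫ x, exp (-π * (s * infDist x K ^ 2)) := by
  have h : ∀ x, infDist x K = infDist (x - x₀) ((fun x => x - x₀) '' K) := fun x =>
    (infDist_image (Isometry.of_dist_eq fun a b => dist_sub_right a b x₀)).symm
  rw [wills_smul (sqrt_pos.mpr hs), sq_sqrt hs.le]
  simp_rw [h]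
  rw [integral_sub_right_eq_self
    (fun x => exp (-π * (s * infDist x ((fun x => x - x₀) '' K) ^ 2)))]

theorem integral_exp_neg_mul_infDist_sq_pos (hKb : Bornology.IsBounded K) (hx₀ : x₀ ∈ K) {s : ℝ}
    (hs : 0 < s) : 0 < ∫ x, exp (-π * (s * infDist x K ^ 2)) := by
  have h1 : 1 ≤ wills (√s • ((fun x => x - x₀) '' K)) := by
    refine one_le_wills ⟨0, ⟨x₀, hx₀, sub_self _⟩, smul_zero _⟩ (Bornology.IsBounded.smul₀ ?_ _)
    exact (Isometry.of_dist_eq fun a b => dist_sub_right a b x₀).lipschitz.isBounded_image hKb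
  rw [wills_sqrt_smul_image_sub hs] at h1
  exact pos_of_mul_pos_right (zero_lt_one.trans_le h1) (by positivity)

variable {Ω : Type*} [MeasurableSpace Ω] {P : Measure Ω} {X : Ω → EuclideanSpace ℝ (Fin d)}

theorem integrable_and_cgf_infDist_sq (hX : Measurable X) (hKb : Bornology.IsBounded K)
    (hx₀ : x₀ ∈ K)
    (hlaw : Measure.map X P = volume.withDensity (fun x =>
      ENNReal.ofReal (exp (-π * infDist x K ^ 2) /
        ∫ y : EuclideanSpace ℝ (Fin d), exp (-π * infDist y K ^ 2)))) {θ : ℝ} (hθ : θ < 1) :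
    Integrable (fun ω => exp (θ * (π * infDist (X ω) K ^ 2))) P ∧
      cgf (fun ω => π * infDist (X ω) K ^ 2) P θ =
        log (wills (√(1 - θ) • ((fun x => x - x₀) '' K))) - d / 2 * log (1 - θ)
          - log (wills ((1 : ℝ) • ((fun x => x - x₀) '' K))) := by
  set W := ∫ y : EuclideanSpace ℝ (Fin d), exp (-π * infDist y K ^ 2) with hW
  have hs : 0 < 1 - θ := by linarith
  have hJ := integral_exp_neg_mul_infDist_sq_pos hKb hx₀ hs
  set J := ∫ x, exp (-π * ((1 - θ) * infDist x K ^ 2)) with hJdef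
  have hWpos : 0 < W := by simpa [hW] using integral_exp_neg_mul_infDist_sq_pos hKb hx₀ zero_lt_one
  have hW1 : wills ((1 : ℝ) • ((fun x => x - x₀) '' K)) = W := by
    simpa [hW] using wills_sqrt_smul_image_sub (K := K) (x₀ := x₀) zero_lt_one
  have hmeas : Measurable fun x : EuclideanSpace ℝ (Fin d) =>
      exp (θ * (π * infDist x K ^ 2)) := by fun_prop
  have hmeasd : Measurable fun x : EuclideanSpace ℝ (Fin d) =>
      ENNReal.ofReal (exp (-π * infDist x K ^ 2) / W) := by fun_prop
  have hden : ∀ x : EuclideanSpace ℝ (Fin d),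
      (ENNReal.ofReal (exp (-π * infDist x K ^ 2) / W)).toReal • exp (θ * (π * infDist x K ^ 2))
        = exp (-π * ((1 - θ) * infDist x K ^ 2)) / W := fun x => by
    rw [ENNReal.toReal_ofReal (by positivity), smul_eq_mul, div_mul_eq_mul_div, ← exp_add]
    ring_nf
  have hint : Integrable (fun ω => exp (θ * (π * infDist (X ω) K ^ 2))) P := by
    refine Integrable.comp_measurable
      (g := fun x : EuclideanSpace ℝ (Fin d) => exp (θ * (π * infDist x K ^ 2))) ?_ hX
    rw [hlaw, integrable_withDensity_iff_integrable_smul' hmeasd (by simp)]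
    simp_rw [hden]
    exact (not_imp_comm.1 integral_undef hJ.ne').div_const _
  refine ⟨hint, ?_⟩
  have hmgf : mgf (fun ω => π * infDist (X ω) K ^ 2) P θ = J / W := by
    rw [mgf, ← integral_map (φ := X) hX.aemeasurable hmeas.aestronglyMeasurable, hlaw,
      integral_withDensity_eq_integral_toReal_smul hmeasd (by simp)]
    simp_rw [hden]
    rw [integral_div]
  rw [cgf, hmgf, hW1, wills_sqrt_smul_image_sub hs, log_div hJ.ne' hWpos.ne',
    log_mul (pow_pos (sqrt_pos.mpr hs) _).ne' hJ.ne', log_pow, log_sqrt hs.le]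
  ring

theorem abs_cgf_infDist_sq_sub_le [IsProbabilityMeasure P] (hX : Measurable X) (hKc : IsCompact K)
    (hKv : Convex ℝ K) (hK : K.Nonempty)
    (hlaw : Measure.map X P = volume.withDensity (fun x =>
      ENNReal.ofReal (exp (-π * infDist x K ^ 2) /
        ∫ y : EuclideanSpace ℝ (Fin d), exp (-π * infDist y K ^ 2)))) {η : ℝ} (hη : 0 < η)
    {θ : ℝ} (hθ : θ < 1) :
    |cgf (fun ω => π * infDist (X ω) K ^ 2) P θ - θ * P[fun ω => π * infDist (X ω) K ^ 2]
        - d / 2 * (-log (1 - θ) - θ)|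
      ≤ (π * diam K ^ 2 + (π * diam K ^ 2 / η + d * η / 2)) * θ ^ 2 := by
  obtain ⟨x₀, hx₀⟩ := hK
  set L : Set (EuclideanSpace ℝ (Fin d)) := (fun x => x - x₀) '' K with hL
  have hLc : IsCompact L := hKc.image (by fun_prop)
  have hLv : Convex ℝ L := by
    have := hKv.translate (-x₀)
    simpa only [hL, sub_eq_neg_add] using this
  have h0 : (0 : EuclideanSpace ℝ (Fin d)) ∈ L := ⟨x₀, hx₀, sub_self _⟩
  have hLR : L ⊆ closedBall 0 (diam K) := by
    rintro _ ⟨x, hx, rfl⟩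
    rw [mem_closedBall_zero_iff, ← dist_eq_norm]
    exact dist_le_diam_of_mem hKc.isBounded hx hx₀
  have hnn : ∀ t : ℝ, 0 ≤ log (wills (t • L)) := fun t =>
    log_nonneg (one_le_wills ⟨0, h0, smul_zero _⟩ (hLc.smul t).isBounded)
  have key := abs_cgf_sub_le (G := fun t => log (wills (t • L))) (c := π * diam K ^ 2)
    (fun θ hθ => (integrable_and_cgf_infDist_sq hX hKc.isBounded hx₀ hlaw hθ).1)
    (fun θ hθ => (integrable_and_cgf_infDist_sq hX hKc.isBounded hx₀ hlaw hθ).2)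
    (concaveOn_log_wills hLc hLv h0) (convexOn_log_wills_add hLc h0 hLR) (hnn _) (hnn _) hθ
    (by positivity)
  refine key.trans (mul_le_mul_of_nonneg_right ?_ (sq_nonneg θ))
  rw [one_smul]
  gcongr
  exact log_wills_le ⟨0, h0⟩ hLR hη (zero_lt_one.trans_le (one_le_wills h0 hLc.isBounded))

end HadwigerWills

section CentralLimit

open Filter

variable {Ω : ℕ → Type*} [∀ n, MeasurableSpace (Ω n)] {P : (n : ℕ) → Measure (Ω n)}
  {V : (n : ℕ) → Ω n → ℝ} {δ C : ℕ → ℝ}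

theorem tendsto_centered_cgf
    (h : ∀ n, ∀ θ < 1, |cgf (V n) (P n) θ - θ * (P n)[V n] - δ n / 2 * (-log (1 - θ) - θ)|
      ≤ C n * θ ^ 2)
    (hδ : Tendsto δ atTop atTop) (hC : Tendsto (fun n => C n / δ n) atTop (nhds 0))
    {x : ℕ → ℝ} (hx : Tendsto x atTop (nhds 0)) {b : ℝ}
    (hb : Tendsto (fun n => δ n * x n ^ 2) atTop (nhds b)) :
    Tendsto (fun n => cgf (V n) (P n) (x n) - x n * (P n)[V n]) atTop (nhds (b / 4)) := by
  have hxa := hx.abs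
  rw [abs_zero] at hxa
  have hlim : Tendsto (fun n => C n / δ n * (δ n * x n ^ 2) + δ n * x n ^ 2 * |x n|) atTop
      (nhds 0) := by
    simpa using (hC.mul hb).add (hb.mul hxa)
  have hdiff : Tendsto (fun n => cgf (V n) (P n) (x n) - x n * (P n)[V n] - δ n * x n ^ 2 / 4) atTop
      (nhds 0) := by
    refine squeeze_zero_norm' ?_ hlim
    filter_upwards [hδ.eventually_gt_atTop 0, hxa.eventually_le_const (u := 1 / 2) (by norm_num)]
      with n hn hxn
    have h1 := h n (x n) (by linarith [le_abs_self (x n)])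
    have h2 := mul_le_mul_of_nonneg_left (abs_neg_log_one_sub_sub_le hxn) (half_pos hn).le
    rw [← abs_of_pos (half_pos hn), ← abs_mul, abs_of_pos (half_pos hn)] at h2
    calc |cgf (V n) (P n) (x n) - x n * (P n)[V n] - δ n * x n ^ 2 / 4|
        = |(cgf (V n) (P n) (x n) - x n * (P n)[V n] - δ n / 2 * (-log (1 - x n) - x n))
          + δ n / 2 * (-log (1 - x n) - x n - x n ^ 2 / 2)| := by ring_nf
      _ ≤ C n * x n ^ 2 + δ n / 2 * (2 * |x n| ^ 3) := (abs_add_le _ _).trans (add_le_add h1 h2)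
      _ = C n / δ n * (δ n * x n ^ 2) + δ n * x n ^ 2 * |x n| := by
        rw [← sq_abs (x n)]
        field_simp
  simpa using hdiff.add (hb.div_const 4)

variable [∀ n, IsProbabilityMeasure (P n)]

theorem tendsto_variance_div
    (hint : ∀ n, ∀ θ < 1, Integrable (fun ω => exp (θ * V n ω)) (P n))
    (h : ∀ n, ∀ θ < 1, |cgf (V n) (P n) θ - θ * (P n)[V n] - δ n / 2 * (-log (1 - θ) - θ)|
      ≤ C n * θ ^ 2)
    (hδ : Tendsto δ atTop atTop) (hC : Tendsto (fun n => C n / δ n) atTop (nhds 0)) :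
    Tendsto (fun n => variance (V n) (P n) / δ n) atTop (nhds (1 / 2)) := by
  rw [tendsto_iff_norm_sub_tendsto_zero]
  have h2 := hC.const_mul 2
  rw [mul_zero] at h2
  refine squeeze_zero' (Eventually.of_forall fun n => norm_nonneg _) ?_ h2
  filter_upwards [hδ.eventually_gt_atTop 0] with n hn
  have := abs_variance_sub_le (hint n) (h n)
  rw [norm_eq_abs, show variance (V n) (P n) / δ n - 1 / 2
    = (variance (V n) (P n) - δ n / 2) / δ n by field_simp, abs_div, abs_of_pos hn,
    ← mul_div_assoc]
  gcongr

theorem tendsto_integral_standardized (hV : ∀ n, AEMeasurable (V n) (P n))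
    (hint : ∀ n, ∀ θ < 1, Integrable (fun ω => exp (θ * V n ω)) (P n))
    (h : ∀ n, ∀ θ < 1, |cgf (V n) (P n) θ - θ * (P n)[V n] - δ n / 2 * (-log (1 - θ) - θ)|
      ≤ C n * θ ^ 2)
    (hδ : Tendsto δ atTop atTop) (hC : Tendsto (fun n => C n / δ n) atTop (nhds 0))
    (f : BoundedContinuousFunction ℝ ℝ) :
    Tendsto (fun n => ∫ ω, f ((V n ω - (P n)[V n]) / √(variance (V n) (P n))) ∂(P n)) atTop
      (nhds (∫ x, f x ∂(gaussianReal 0 1))) := by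
  set σ : ℕ → ℝ := fun n => √(variance (V n) (P n)) with hσ
  have hv := tendsto_variance_div hint h hδ hC
  have hvtop : Tendsto (fun n => variance (V n) (P n)) atTop atTop := by
    refine (hv.pos_mul_atTop (by norm_num) hδ).congr' ?_
    filter_upwards [hδ.eventually_gt_atTop 0] with n hn
    field_simp
  have hσtop : Tendsto σ atTop atTop := tendsto_sqrt_atTop.comp hvtop
  have hx : ∀ t, Tendsto (fun n => t / σ n) atTop (nhds 0) := fun t =>
    tendsto_const_nhds.div_atTop hσtop
  have hb : ∀ t, Tendsto (fun n => δ n * (t / σ n) ^ 2) atTop (nhds (2 * t ^ 2)) := fun t => by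
    have h1 := (hv.inv₀ (by norm_num)).mul_const (t ^ 2)
    rw [one_div, inv_inv] at h1
    refine h1.congr fun n => ?_
    rw [div_pow, hσ, sq_sqrt (variance_nonneg _ _), inv_div]
    ring
  have hY : ∀ n, AEMeasurable (fun ω => (V n ω - (P n)[V n]) / σ n) (P n) := fun n =>
    ((hV n).sub_const _).div_const _
  have hYexp : ∀ t n, (fun ω => exp (t * ((V n ω - (P n)[V n]) / σ n)))
      = fun ω => exp (t / σ n * (V n ω - (P n)[V n])) := fun t n => by
    ext ω
    ring_nf
  have hYint : ∀ t, ∀ᶠ n in atTop,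
      Integrable (fun ω => exp (t * ((V n ω - (P n)[V n]) / σ n))) (P n) := fun t => by
    filter_upwards [(hx t).eventually_lt_const zero_lt_one] with n hn
    rw [hYexp]
    refine ((hint n _ hn).mul_const (exp (-(t / σ n * (P n)[V n])))).congr
      (Eventually.of_forall fun ω => ?_)
    simp only [← exp_add]
    ring_nf
  have hYlim : ∀ t, Tendsto (fun n => ∫ ω, exp (t * ((V n ω - (P n)[V n]) / σ n)) ∂(P n)) atTop
      (nhds (exp (t ^ 2 / 2))) := fun t => by
    have h1 := (tendsto_centered_cgf h hδ hC (hx t) (hb t)).rexp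
    rw [show 2 * t ^ 2 / 4 = t ^ 2 / 2 by ring] at h1
    refine h1.congr' ?_
    filter_upwards [(hx t).eventually_lt_const zero_lt_one, hYint t] with n hn hi
    rw [hYexp] at hi ⊢
    rw [← cgf_sub_const (hint n _ hn), exp_cgf hi, mgf]
  let μ : ℕ → ProbabilityMeasure ℝ := fun n =>
    ⟨(P n).map fun ω => (V n ω - (P n)[V n]) / σ n, Measure.isProbabilityMeasure_map (hY n)⟩
  let ν : ProbabilityMeasure ℝ := ⟨gaussianReal 0 1, inferInstance⟩
  have hexpm : ∀ (n : ℕ) (t : ℝ), AEStronglyMeasurable (fun x : ℝ => exp (t * x))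
      ((P n).map fun ω => (V n ω - (P n)[V n]) / σ n) := fun n t =>
    (by fun_prop : Measurable fun x : ℝ => exp (t * x)).aestronglyMeasurable
  have hweak : Tendsto μ atTop (nhds ν) := by
    refine tendsto_of_tendsto_integral_exp (fun t => integrable_exp_mul_gaussianReal t)
      (fun t => ?_) fun t => ?_
    · filter_upwards [hYint t] with n hn
      exact (integrable_map_measure (hexpm n t) (hY n)).mpr hn
    · have hg : ∫ x, exp (t * x) ∂(gaussianReal 0 1) = exp (t ^ 2 / 2) := by
        have := congrFun (mgf_id_gaussianReal (μ := 0) (v := 1)) t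
        simpa [mgf] using this
      refine (hg ▸ hYlim t).congr fun n => ?_
      exact (integral_map (hY n) (hexpm n t)).symm
  refine ((ProbabilityMeasure.tendsto_iff_forall_integral_tendsto.mp hweak) f).congr fun n => ?_
  exact integral_map (hY n) f.continuous.measurable.aestronglyMeasurable

end CentralLimit

end

theorem clt_for_dist_sq
    (α : ℝ) (hα : α ∈ Set.Ico (0:ℝ) (1/2))
    (d : ℕ → ℕ) (hd : Filter.Tendsto d Filter.atTop Filter.atTop)
    (K : (n : ℕ) → Set (EuclideanSpace ℝ (Fin (d n))))
    (hKcomp : ∀ n, IsCompact (K n))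
    (hKconv : ∀ n, Convex ℝ (K n))
    (hKint : ∀ n, (interior (K n)).Nonempty)
    (hKdiam : ∃ C : ℝ, ∀ n, Metric.diam (K n) ≤ C * (d n : ℝ) ^ α)
    (Ω : ℕ → Type) (mΩ : ∀ n, MeasurableSpace (Ω n))
    (P : (n : ℕ) → Measure (Ω n)) (hP : ∀ n, IsProbabilityMeasure (P n))
    (X : (n : ℕ) → Ω n → EuclideanSpace ℝ (Fin (d n)))
    (hX : ∀ n, Measurable (X n))
    (hlaw : ∀ n, Measure.map (X n) (P n) = volume.withDensity (fun x =>
      ENNReal.ofReal (Real.exp (-π * Metric.infDist x (K n) ^ 2) /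
        ∫ y : EuclideanSpace ℝ (Fin (d n)), Real.exp (-π * Metric.infDist y (K n) ^ 2)))) :
    ∀ f : BoundedContinuousFunction ℝ ℝ,
      Filter.Tendsto
        (fun n => ∫ ω,
          f ((Metric.infDist ((X n) ω) (K n) ^ 2 -
              ∫ ω', Metric.infDist ((X n) ω') (K n) ^ 2 ∂(P n)) /
            Real.sqrt (variance (fun ω' => Metric.infDist ((X n) ω') (K n) ^ 2) (P n)))
          ∂(P n))
        Filter.atTop (nhds (∫ x, f x ∂(gaussianReal 0 1))) := by
  intro f
  obtain ⟨C₀, hC₀⟩ := hKdiam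
  have hne : ∀ n, (K n).Nonempty := fun n => (hKint n).mono interior_subset
  have hdR : Filter.Tendsto (fun n => (d n : ℝ)) Filter.atTop Filter.atTop :=
    tendsto_natCast_atTop_atTop.comp hd
  set η : ℕ → ℝ := fun n => if d n = 0 then 1 else (d n : ℝ) ^ (α - 1 / 2) with hη
  have hη0 : ∀ n, 0 < η n := fun n => by
    by_cases h : d n = 0
    · simp [hη, h]
    · simp only [hη, h, if_false]
      exact rpow_pos_of_pos (by positivity) _
  have hC : Filter.Tendsto (fun n => (π * diam (K n) ^ 2 + (π * diam (K n) ^ 2 / η n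
      + d n * η n / 2)) / d n) Filter.atTop (nhds 0) := by
    have hlim : Filter.Tendsto (fun n => (2 * (π * C₀ ^ 2) + 1 / 2) * (d n : ℝ) ^ (α - 1 / 2))
        Filter.atTop (nhds 0) := by
      have h1 := (tendsto_rpow_neg_atTop (y := 1 / 2 - α) (by linarith [hα.2])).comp hdR
      simpa [Function.comp_def] using h1.const_mul (2 * (π * C₀ ^ 2) + 1 / 2)
    refine squeeze_zero' (Filter.Eventually.of_forall fun n => ?_) ?_ hlim
    · have := (hη0 n).le
      positivity
    · filter_upwards [hd.eventually_ge_atTop 1] with n hn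
      have hd1 : (1 : ℝ) ≤ d n := by exact_mod_cast hn
      have hd0 : (0 : ℝ) < d n := by linarith
      have hηn : η n = (d n : ℝ) ^ (α - 1 / 2) := if_neg (by omega)
      have hη1 : η n ≤ 1 := by
        rw [hηn]
        exact rpow_le_one_of_one_le_of_nonpos hd1 (by linarith [hα.2])
      have hdiam : diam (K n) ^ 2 ≤ C₀ ^ 2 * (η n ^ 2 * d n) := by
        have h1 : ((d n : ℝ) ^ α) ^ 2 = η n ^ 2 * d n := by
          rw [hηn, ← rpow_natCast, ← rpow_natCast, ← rpow_mul hd0.le, ← rpow_mul hd0.le,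
            ← rpow_add_one hd0.ne']
          congr 1
          push_cast
          ring
        rw [← h1, ← mul_pow]
        exact pow_le_pow_left₀ diam_nonneg (hC₀ n) 2
      have h2 : π * diam (K n) ^ 2 / η n ≤ π * C₀ ^ 2 * η n * d n := by
        rw [div_le_iff₀ (hη0 n)]
        calc π * diam (K n) ^ 2 ≤ π * (C₀ ^ 2 * (η n ^ 2 * d n)) := by gcongr
          _ = _ := by ring
      have h3 : π * diam (K n) ^ 2 ≤ π * diam (K n) ^ 2 / η n :=
        le_div_self (by positivity) (hη0 n) hη1
      rw [← hηn, div_le_iff₀ hd0]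
      linarith
  have key := tendsto_integral_standardized (V := fun n ω => π * infDist (X n ω) (K n) ^ 2)
    (fun n => by have := hX n; fun_prop)
    (fun n θ hθ => (integrable_and_cgf_infDist_sq (hX n) (hKcomp n).isBounded (hne n).some_mem
      (hlaw n) hθ).1)
    (fun n θ hθ => abs_cgf_infDist_sq_sub_le (hX n) (hKcomp n) (hKconv n) (hne n) (hlaw n)
      (hη0 n) hθ) hdR hC f
  refine key.congr fun n => integral_congr_ae (Filter.Eventually.of_forall fun ω => ?_)
  simp only
  rw [integral_const_mul, variance_const_mul, ← mul_sub, sqrt_mul (sq_nonneg π), sqrt_sq pi_pos.le,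
    mul_div_mul_left _ _ pi_ne_zero]
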